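/- Let s ≥ 1, let Ω ⊂ ℂ^s be a finite set, let f_ω ∈ ℂ for ω ∈ Ω, and define f: ℤ^s → ℂ by f(x) = ∑_{ω∈Ω} f_ω e^{ωᵀx}. Let A, B ⊂ ℕ₀^s be finite sets and let F_{A,B} = [f(α−β)]_{α∈A, β∈B} be the associated Hankel-type matrix. If the polynomial p(z) = ∑_{β∈B} p_β z^β (with z^β = z₁^{β₁}⋯z_s^{β_s}) vanishes at every point e^{−ω} := (e^{−ω₁},…,e^{−ω_s}) with ω ∈ Ω, then the coefficient vector (p_β)_{β∈B} lies in the kernel of F_{A,B}. -/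

import Mathlib

open Matrix

/-- The exponential `x ↦ e^{ωᵀx}` splits over a difference of multi-indices. -/
theorem exp_sum_mul_sub {ι : Type*} [Fintype ι] (ω : ι → ℂ) (α β : ι → ℕ) :
    Complex.exp (∑ i, ω i * (((α i : ℤ) - (β i : ℤ) : ℤ) : ℂ)) =
      (∏ i, Complex.exp (ω i) ^ α i) * ∏ i, Complex.exp (-ω i) ^ β i := by
  rw [Complex.exp_sum, ← Finset.prod_mul_distrib]
  refine Finset.prod_congr rfl fun i _ => ?_
  rw [← Complex.exp_nat_mul, ← Complex.exp_nat_mul, ← Complex.exp_add]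
  push_cast
  ring_nf

/-- one direction of the structure theorem of the multivariate Prony method.
If `f(x) = ∑_{ω∈Ω} f_ω e^{ωᵀx}` and the polynomial `p(z) = ∑_{β∈B} p_β z^β` vanishes at
every point `e^{−ω}`, `ω ∈ Ω`, then the coefficient vector `(p_β)_{β∈B}` lies in the kernel
of the Hankel-type matrix `F_{A,B} = [f(α−β)]_{α∈A,β∈B}`. -/
theorem prony_vanishing_mem_kernel
    (s : ℕ) (hs : 1 ≤ s)
    (Ω : Finset (Fin s → ℂ)) (c : (Fin s → ℂ) → ℂ)
    (f : (Fin s → ℤ) → ℂ)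
    (hf : f = fun x => ∑ ω ∈ Ω, c ω * Complex.exp (∑ i, ω i * (x i : ℂ)))
    (A B : Finset (Fin s → ℕ))
    (F : Matrix A B ℂ)
    (hF : ∀ (α : A) (β : B), F α β = f (fun i => (α.1 i : ℤ) - (β.1 i : ℤ)))
    (p : B → ℂ)
    (hvanish : ∀ ω ∈ Ω, ∑ β : B, p β * ∏ i, Complex.exp (-ω i) ^ (β.1 i) = 0) :
    F.mulVec p = 0 := by
  ext α
  simp only [Matrix.mulVec, dotProduct, hF, hf, exp_sum_mul_sub, Finset.sum_mul, Pi.zero_apply]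
  rw [Finset.sum_comm]
  refine Finset.sum_eq_zero fun ω hω => ?_
  calc
    _ = (c ω * ∏ i, Complex.exp (ω i) ^ α.1 i) *
          ∑ β : B, p β * ∏ i, Complex.exp (-ω i) ^ β.1 i := by
      rw [Finset.mul_sum]
      exact Finset.sum_congr rfl fun β _ => by ring
    _ = 0 := by rw [hvanish ω hω, mul_zero]
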